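/- If A is a ULH superpattern of a matrix of ℋ in which two distinct variables x_r and x_s lie on the same k-subdiagonal (i.e., A ∈ ℋ̃ ∖ 𝒟̃), then A is not a companion matrix. -/

import Mathlib

open Polynomial Matrix

noncomputable section

/-- A square matrix is *unit lower Hessenberg* (ULH): every entry on the
superdiagonal equals `1` and every entry above the superdiagonal equals `0`. -/
def IsULH {R : Type*} [Zero R] [One R] {m : ℕ} (A : Matrix (Fin m) (Fin m) R) : Prop :=
  (∀ i j : Fin m, (j : ℕ) = (i : ℕ) + 1 → A i j = 1) ∧
  (∀ i j : Fin m, (i : ℕ) + 1 < (j : ℕ) → A i j = 0)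

/-- The total order `≺` on positions: `(i,j) ≺ (i',j')` iff `i−j < i'−j'`, or
`i−j = i'−j'` and `i < i'`. -/
def Prec {m : ℕ} (a b : Fin m × Fin m) : Prop :=
  ((a.1 : ℕ) - (a.2 : ℕ) < (b.1 : ℕ) - (b.2 : ℕ)) ∨
  ((a.1 : ℕ) - (a.2 : ℕ) = (b.1 : ℕ) - (b.2 : ℕ) ∧ (a.1 : ℕ) < (b.1 : ℕ))

/-- `pos` is a valid family of variable positions for a matrix of `ℋ`:
each position is on or below the main diagonal, and the positions are
strictly increasing in the order `≺`. -/
def IsHPos {m : ℕ} (pos : Fin m → Fin m × Fin m) : Prop :=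
  (∀ k, ((pos k).2 : ℕ) ≤ ((pos k).1 : ℕ)) ∧
  (∀ k l : Fin m, k < l → Prec (pos k) (pos l))

/-- `pos` is a valid family of variable positions for a matrix of `ℬ`:
in addition all variables lie in a common `t`-block, i.e.
`max j_k ≤ min i_k`. -/
def IsBPos {m : ℕ} (pos : Fin m → Fin m × Fin m) : Prop :=
  IsHPos pos ∧ ∀ k l : Fin m, ((pos k).2 : ℕ) ≤ ((pos l).1 : ℕ)

/-- The ULH matrix `H_{(i₁,j₁),…,(iₙ,jₙ)}` with `2n−1` nonzero entries: ones on the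
superdiagonal and the variable `xₖ` at position `pos k` (0-indexed). -/
def HMat (F : Type*) [Field F] {n : ℕ} (pos : Fin n → Fin n × Fin n) :
    Matrix (Fin n) (Fin n) (MvPolynomial (Fin n) F) :=
  fun i j => (if (j : ℕ) = (i : ℕ) + 1 then 1 else 0) +
    ∑ k : Fin n, if pos k = (i, j) then MvPolynomial.X k else 0

/-- The positions of the variables of `C_{i₁,…,iₙ}`: in 1-based terms `xₖ` lies at
`(iₖ, iₖ−k+1)`; here 0-indexed, given the row function `r`, the variable `x_{k+1}`
lies at `(r k, r k − k)`. -/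
def CPos {n : ℕ} (r : Fin n → Fin n) (k : Fin n) : Fin n × Fin n :=
  (r k, ⟨(r k : ℕ) - (k : ℕ), lt_of_le_of_lt (Nat.sub_le _ _) (r k).isLt⟩)

/-- The condition on the row indices defining the set `𝒞`: in 1-based terms
`k ≤ iₖ` and `iₖ−k+1 ≤ i₁ ≤ iₖ` for `k = 1,…,n`. -/
def IsCIdx {n : ℕ} (hn : 0 < n) (r : Fin n → Fin n) : Prop :=
  ∀ k : Fin n, (k : ℕ) ≤ (r k : ℕ) ∧
    (r k : ℕ) - (k : ℕ) ≤ (r ⟨0, hn⟩ : ℕ) ∧ (r ⟨0, hn⟩ : ℕ) ≤ (r k : ℕ)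

/-- The matrix `C_{i₁,…,iₙ}`. -/
def CMat (F : Type*) [Field F] {n : ℕ} (r : Fin n → Fin n) :
    Matrix (Fin n) (Fin n) (MvPolynomial (Fin n) F) :=
  HMat F (CPos r)

/-- The condition on the row indices defining the set `𝒢`: besides the `𝒞` conditions,
the rows of the variables are exactly `i₁,…,n` and their columns exactly `1,…,i₁`. -/
def IsGIdx {n : ℕ} (hn : 0 < n) (r : Fin n → Fin n) : Prop :=
  IsCIdx hn r ∧
  (∀ i : Fin n, (∃ k, r k = i) ↔ (r ⟨0, hn⟩ : ℕ) ≤ (i : ℕ)) ∧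
  (∀ j : Fin n, (∃ k, (r k : ℕ) - (k : ℕ) = (j : ℕ)) ↔ (j : ℕ) ≤ (r ⟨0, hn⟩ : ℕ))

/-- The condition on the row indices defining the set `ℱ` of Fiedler companion
matrices: besides the `𝒢` conditions, consecutive variables lie in the same row or
the same column, i.e. `i_{k+1} = i_k` or `i_{k+1} = i_k + 1`. -/
def IsFIdx {n : ℕ} (hn : 0 < n) (r : Fin n → Fin n) : Prop :=
  IsGIdx hn r ∧
  ∀ k l : Fin n, (l : ℕ) = (k : ℕ) + 1 → (r l = r k ∨ (r l : ℕ) = (r k : ℕ) + 1)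

/-- `B` is a *ULH superpattern* of `A`: `B` is obtained from `A` by replacing some
(possibly none) zero entries of `A` lying below the superdiagonal by nonzero
constants of `F`. -/
def IsULHSuperpatternOf {F : Type*} [Field F] {n : ℕ}
    (B A : Matrix (Fin n) (Fin n) (MvPolynomial (Fin n) F)) : Prop :=
  (∀ i j : Fin n, (i : ℕ) < (j : ℕ) → B i j = A i j) ∧
  (∀ i j : Fin n, (j : ℕ) ≤ (i : ℕ) →
    B i j = A i j ∨ (A i j = 0 ∧ ∃ c : F, c ≠ 0 ∧ B i j = MvPolynomial.C c))

/-- `A` is a *companion matrix*: `n` of its entries are the variables `x₁,…,xₙ`,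
the remaining entries are constants of `F`, and
`det(λI − A) = λⁿ − x₁λ^{n−1} − ⋯ − xₙ`. -/
def IsCompanion {F : Type*} [Field F] {n : ℕ}
    (A : Matrix (Fin n) (Fin n) (MvPolynomial (Fin n) F)) : Prop :=
  (∃ pos : Fin n → Fin n × Fin n, Function.Injective pos ∧
    (∀ k : Fin n, A (pos k).1 (pos k).2 = MvPolynomial.X k) ∧
    (∀ i j : Fin n, (∀ k, pos k ≠ (i, j)) → ∃ c : F, A i j = MvPolynomial.C c)) ∧
  A.charpoly = Polynomial.X ^ n -
    ∑ k : Fin n, Polynomial.C (MvPolynomial.X k) * Polynomial.X ^ (n - 1 - (k : ℕ))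

/-- `A` is a *PB-companion matrix* (companion with respect to a polynomial basis):
`n` of its entries are the variables `x₁,…,xₙ`, the remaining entries are constants
of `F`, and `det(λI − A) = pₙ(λ) − x₁p_{n−1}(λ) − ⋯ − xₙp₀(λ)` for some basis
`{pₙ,…,p₀}` of the space `F_n[λ]` of polynomials of degree at most `n`. -/
def IsPBCompanion {F : Type*} [Field F] {n : ℕ}
    (A : Matrix (Fin n) (Fin n) (MvPolynomial (Fin n) F)) : Prop :=
  (∃ pos : Fin n → Fin n × Fin n, Function.Injective pos ∧
    (∀ k : Fin n, A (pos k).1 (pos k).2 = MvPolynomial.X k) ∧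
    (∀ i j : Fin n, (∀ k, pos k ≠ (i, j)) → ∃ c : F, A i j = MvPolynomial.C c)) ∧
  ∃ p : Fin (n + 1) → Polynomial F,
    (∀ i, p i ∈ Polynomial.degreeLT F (n + 1)) ∧
    LinearIndependent F p ∧
    Submodule.span F (Set.range p) = Polynomial.degreeLT F (n + 1) ∧
    A.charpoly = (p ⟨n, n.lt_succ_self⟩).map (MvPolynomial.C : F →+* MvPolynomial (Fin n) F) -
      ∑ k : Fin n, Polynomial.C (MvPolynomial.X k) *
        (p ⟨n - 1 - (k : ℕ), by omega⟩).map (MvPolynomial.C : F →+* MvPolynomial (Fin n) F)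

/-- The constant part of `A`: set `x₁ = ⋯ = xₙ = 0` in every entry. -/
def constPart {F : Type*} [Field F] {n : ℕ}
    (A : Matrix (Fin n) (Fin n) (MvPolynomial (Fin n) F)) : Matrix (Fin n) (Fin n) F :=
  A.map (fun q => MvPolynomial.eval (fun _ => (0 : F)) q)

/-- The leading principal submatrix `A[1,…,m]` of order `m`. -/
def leadSub {R : Type*} {n : ℕ} (A : Matrix (Fin n) (Fin n) R) (m : ℕ) (h : m ≤ n) :
    Matrix (Fin m) (Fin m) R :=
  A.submatrix (Fin.castLE h) (Fin.castLE h)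

/-- The trailing principal submatrix `A[n−m+1,…,n]` of order `m`. -/
def trailSub {R : Type*} {n : ℕ} (A : Matrix (Fin n) (Fin n) R) (m : ℕ) (h : m ≤ n) :
    Matrix (Fin m) (Fin m) R :=
  A.submatrix (fun i => ⟨n - m + (i : ℕ), by omega⟩) (fun i => ⟨n - m + (i : ℕ), by omega⟩)

/-- A matrix whose entries are all constants of `F`. -/
def IsConstMatrix {F : Type*} [Field F] {n m : ℕ}
    (M : Matrix (Fin m) (Fin m) (MvPolynomial (Fin n) F)) : Prop :=
  ∀ i j, ∃ c : F, M i j = MvPolynomial.C c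

/-- Membership in `𝔑^m_L(n₁,…,n_s)`: a constant ULH matrix of order `m` whose
leading principal submatrix of order `ns h` is nilpotent whenever `ns h ≠ 0`. -/
def MemNL {F : Type*} [Field F] {m : ℕ} (M : Matrix (Fin m) (Fin m) F)
    {s : ℕ} (ns : Fin s → ℕ) (hns : ∀ h, ns h ≤ m) : Prop :=
  IsULH M ∧ ∀ h : Fin s, ns h ≠ 0 → IsNilpotent (leadSub M (ns h) (hns h))

/-- Membership in `𝔑^m_T(n₁,…,n_s)`: a constant ULH matrix of order `m` whose
trailing principal submatrix of order `ns h` is nilpotent whenever `ns h ≠ 0`. -/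
def MemNT {F : Type*} [Field F] {m : ℕ} (M : Matrix (Fin m) (Fin m) F)
    {s : ℕ} (ns : Fin s → ℕ) (hns : ∀ h, ns h ≤ m) : Prop :=
  IsULH M ∧ ∀ h : Fin s, ns h ≠ 0 → IsNilpotent (trailSub M (ns h) (hns h))

/-- `s_k(A)`: the sum of the entries of the `k`-subdiagonal of `A`. -/
def subdiagSum {F : Type*} [Field F] {n : ℕ}
    (A : Matrix (Fin n) (Fin n) (MvPolynomial (Fin n) F)) (k : ℕ) : MvPolynomial (Fin n) F :=
  ∑ i : Fin n, ∑ j : Fin n, if (i : ℕ) = (j : ℕ) + k then A i j else 0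

/-- The upper shift matrix `Uₘ`: ones on the superdiagonal, zeros elsewhere. -/
def Ushift (R : Type*) [Zero R] [One R] (m : ℕ) : Matrix (Fin m) (Fin m) R :=
  fun i j => if (j : ℕ) = (i : ℕ) + 1 then 1 else 0

/-- The backward identity matrix `Jₘ`: ones on the antidiagonal, zeros elsewhere. -/
def Jmat (R : Type*) [Zero R] [One R] (m : ℕ) : Matrix (Fin m) (Fin m) R :=
  fun i j => if (i : ℕ) + (j : ℕ) = m - 1 then 1 else 0

/-- The principal submatrix `M[b,…,e]` on rows and columns `b,…,e` (0-indexed). -/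
def rangeSub {R : Type*} {m : ℕ} (M : Matrix (Fin m) (Fin m) R) (b e : ℕ) (h : e < m) :
    Matrix (Fin (e + 1 - b)) (Fin (e + 1 - b)) R :=
  M.submatrix (fun i => ⟨b + (i : ℕ), by omega⟩) (fun i => ⟨b + (i : ℕ), by omega⟩)

/-- The eigenvector `(1,…,1,0,…,0)` shows that adding a unit entry on or below the diagonal
to the upper shift matrix destroys nilpotency. -/
theorem Ushift_add_single_pow_ne_zero {R : Type*} [CommRing R] [Nontrivial R] {n : ℕ}
    (p q : Fin n) (hqp : q ≤ p) (k : ℕ) : (Ushift R n + Matrix.single p q 1) ^ k ≠ 0 := by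
  set V := Ushift R n + Matrix.single p q 1
  set v : Fin n → R := fun i => if i ≤ p then 1 else 0
  have hV : V *ᵥ v = v := by
    ext i
    have hU : (Ushift R n *ᵥ v) i = if i < p then 1 else 0 := by
      simp only [Matrix.mulVec, dotProduct, Ushift]
      by_cases hi : (i : ℕ) + 1 < n
      · rw [Finset.sum_eq_single ⟨i + 1, hi⟩]
        · simp only [v, Fin.le_def, Fin.lt_def, if_true, one_mul]
          rfl
        · intro j _ hj
          rw [if_neg (fun h => hj (Fin.ext h)), zero_mul]
        · simp
      · rw [Finset.sum_eq_zero, if_neg]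
        · rw [Fin.lt_def]
          omega
        · intro j _
          rw [if_neg (by omega), zero_mul]
    rw [Matrix.add_mulVec, Pi.add_apply, hU, Matrix.single_mulVec]
    rcases lt_trichotomy i p with h | h | h
    · simp [v, h, h.le, h.ne]
    · subst h
      simp [v, hqp]
    · simp [v, h.not_ge, h.not_gt, h.ne']
  have hVk : V ^ k *ᵥ v = v := by
    induction k with
    | zero => simp
    | succ k ih => rw [pow_succ, ← Matrix.mulVec_mulVec, hV, ih]
  intro h
  rw [h, Matrix.zero_mulVec] at hVk
  simpa [v] using congrFun hVk p

/-- Powers of two matrices related by a scaled diagonal conjugation. -/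
theorem pow_apply_of_scaling {R : Type*} [CommRing R] [IsDomain R] {n : ℕ} {s : R} (hs : s ≠ 0)
    {B M : Matrix (Fin n) (Fin n) R}
    (h : ∀ i j : Fin n, s ^ ((i : ℕ) + 1) * B i j = M i j * s ^ (j : ℕ)) (k : ℕ) (i j : Fin n) :
    s ^ ((i : ℕ) + k) * (B ^ k) i j = (M ^ k) i j * s ^ (j : ℕ) := by
  induction k generalizing j with
  | zero =>
    by_cases hij : i = j
    · simp [hij]
    · simp [hij]
  | succ k ih =>
    simp only [pow_succ _ k, Matrix.mul_apply, Finset.mul_sum, Finset.sum_mul]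
    refine Finset.sum_congr rfl fun l _ => ?_
    refine mul_left_cancel₀ (pow_ne_zero (l : ℕ) hs) ?_
    linear_combination (s ^ ((l : ℕ) + 1) * B l j) * ih l + (M ^ k) i l * s ^ (l : ℕ) * h l j

theorem X_dvd_of_X_pow_mul_eq {R : Type*} [CommRing R] [IsDomain R] {k m : ℕ} (hkm : k < m)
    {f g : R[X]} (h : X ^ k * f = X ^ m * g) : X ∣ f := by
  obtain ⟨r, rfl⟩ := Nat.exists_eq_add_of_lt hkm
  rw [add_assoc, pow_add, mul_assoc] at h
  rw [mul_left_cancel₀ (pow_ne_zero k X_ne_zero) h, pow_succ', mul_assoc]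
  exact dvd_mul_right X _

/-- In a ULH matrix with the characteristic polynomial of a companion matrix, each variable
`x_{a+1}` lies on the `a`-subdiagonal. -/
theorem subdiagonal_eq_of_charpoly {F : Type*} [Field F] {n : ℕ}
    {A : Matrix (Fin n) (Fin n) (MvPolynomial (Fin n) F)} (hA : IsULH A)
    {a p q : Fin n} (hqp : q ≤ p) (hpq : A p q = MvPolynomial.X a)
    (hother : ∀ i j, (i, j) ≠ (p, q) →
      (∃ k, k ≠ a ∧ A i j = MvPolynomial.X k) ∨ ∃ c : F, A i j = MvPolynomial.C c)
    (hchar : A.charpoly = Polynomial.X ^ n -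
      ∑ k : Fin n, Polynomial.C (MvPolynomial.X k) * Polynomial.X ^ (n - 1 - (k : ℕ))) :
    (p : ℕ) - (q : ℕ) = (a : ℕ) := by
  set d : ℕ := (p : ℕ) - (q : ℕ) with hd
  have hqp' : (q : ℕ) ≤ p := hqp
  let ι : F[X] →+* RatFunc F := algebraMap F[X] (RatFunc F)
  have hι : Function.Injective ι := RatFunc.algebraMap_injective F
  set s : RatFunc F := ι X
  have hs : s ≠ 0 := (map_ne_zero_iff ι hι).2 X_ne_zero
  set t : RatFunc F := (s ^ (d + 1))⁻¹
  have hst : s ^ (d + 1) * t = 1 := mul_inv_cancel₀ (pow_ne_zero _ hs)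
  let φ : MvPolynomial (Fin n) F →+* RatFunc F :=
    MvPolynomial.eval₂Hom (ι.comp Polynomial.C) (Pi.single a t)
  have hφX : ∀ k, φ (MvPolynomial.X k) = (Pi.single a t : Fin n → RatFunc F) k := fun k =>
    MvPolynomial.eval₂Hom_X' _ _ _
  have hφC : ∀ c, φ (MvPolynomial.C c) = ι (Polynomial.C c) := fun c =>
    MvPolynomial.eval₂Hom_C _ _ _
  set B := A.map φ with hB
  obtain ⟨N, hNdef⟩ : ∃ N : Matrix (Fin n) (Fin n) F[X], ∀ i j, N i j =
      if (i, j) = (p, q) then 1 else X ^ ((i : ℕ) + 1 - j) * Polynomial.C (constPart A i j) :=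
    ⟨Matrix.of fun i j => _, fun _ _ => rfl⟩
  have hscale : ∀ i j : Fin n, s ^ ((i : ℕ) + 1) * B i j = N.map ι i j * s ^ (j : ℕ) := by
    intro i j
    by_cases hij : (i, j) = (p, q)
    · obtain ⟨rfl, rfl⟩ := Prod.mk.inj hij
      have he : (i : ℕ) + 1 = j + (d + 1) := by omega
      simp only [hB, Matrix.map_apply, hNdef, if_true, hpq, hφX, Pi.single_eq_same, map_one, one_mul]
      rw [he, pow_add, mul_assoc, hst, mul_one]
    · have hBij : B i j = ι (Polynomial.C (constPart A i j)) := by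
        rcases hother i j hij with ⟨k, hk, h⟩ | ⟨c, h⟩
        · simp [hB, constPart, h, hφX, hk]
        · simp [hB, constPart, h, hφC]
      simp only [Matrix.map_apply, hNdef, if_neg hij, hBij, map_mul, map_pow]
      by_cases hij' : (j : ℕ) ≤ i + 1
      · have he : (i : ℕ) + 1 = (i + 1 - j) + j := by omega
        conv_lhs => rw [he, pow_add]
        ring
      · simp [constPart, hA.2 i j (by omega)]
  have hCH : B ^ n = t • B ^ (n - 1 - (a : ℕ)) := by
    have h := Matrix.aeval_self_charpoly B
    rw [hB, Matrix.charpoly_map, hchar, ← hB] at h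
    simp only [Polynomial.map_sub, Polynomial.map_pow, Polynomial.map_X, Polynomial.map_sum,
      Polynomial.map_mul, Polynomial.map_C, hφX, map_sub, map_pow, map_sum, map_mul, aeval_X,
      aeval_C] at h
    rw [Finset.sum_eq_single a (fun k _ hk => by simp [hk]) (by simp), sub_eq_zero] at h
    rw [h, Pi.single_eq_same, Algebra.smul_def]
  have hN : ∀ i j, X ^ (d + 1) * (N ^ n) i j = X ^ ((a : ℕ) + 1) * (N ^ (n - 1 - (a : ℕ))) i j := by
    intro i j
    apply hι
    have hpow : ∀ k, ι ((N ^ k) i j) = ((N.map ι) ^ k) i j := fun k =>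
      congrFun (congrFun (Matrix.map_pow (f := ι) N k) i) j
    simp only [map_mul, map_pow, hpow]
    refine mul_right_cancel₀ (pow_ne_zero (j : ℕ) hs) ?_
    rw [mul_assoc, mul_assoc, ← pow_apply_of_scaling hs hscale, ← pow_apply_of_scaling hs hscale,
      hCH, Matrix.smul_apply, smul_eq_mul]
    have he : (i : ℕ) + n = (a + 1) + (i + (n - 1 - a)) := by omega
    rw [he, pow_add s ((a : ℕ) + 1)]
    linear_combination (s ^ ((a : ℕ) + 1) * s ^ ((i : ℕ) + (n - 1 - a)) *
      (B ^ (n - 1 - (a : ℕ))) i j) * hst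
  have hV : N.map (Polynomial.evalRingHom (0 : F)) = Ushift F n + Matrix.single p q 1 := by
    ext i j
    by_cases hij : (i, j) = (p, q)
    · obtain ⟨rfl, rfl⟩ := Prod.mk.inj hij
      have : ¬ ((j : ℕ) = i + 1) := by omega
      simp [hNdef, Ushift, this]
    · have hsingle : (Matrix.single p q (1 : F)) i j = 0 := by
        rw [Matrix.single_apply, if_neg]
        rintro ⟨rfl, rfl⟩
        exact hij rfl
      rw [Matrix.add_apply, hsingle, add_zero]
      simp only [Matrix.map_apply, hNdef, if_neg hij, Ushift, coe_evalRingHom, eval_mul, eval_pow,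
        eval_X, eval_C]
      rcases lt_trichotomy (j : ℕ) (i + 1) with h | h | h
      · rw [zero_pow (by omega), zero_mul, if_neg h.ne]
      · simp [constPart, h, hA.1 i j h]
      · simp [constPart, h.ne', hA.2 i j h]
  have hVpow : ∀ k, (∀ i j, X ∣ (N ^ k) i j) → False := by
    intro k hk
    apply Ushift_add_single_pow_ne_zero (R := F) p q hqp k
    rw [← hV, ← Matrix.map_pow N]
    ext i j
    obtain ⟨r, hr⟩ := hk i j
    simp [hr]
  rcases lt_trichotomy d a with h | h | h
  · exact (hVpow n fun i j => X_dvd_of_X_pow_mul_eq (by omega) (hN i j)).elim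
  · exact h
  · exact (hVpow (n - 1 - a) fun i j => X_dvd_of_X_pow_mul_eq (by omega) (hN i j).symm).elim

theorem IsHPos.injective {m : ℕ} {pos : Fin m → Fin m × Fin m} (hpos : IsHPos pos) :
    Function.Injective pos := by
  intro k l h
  by_contra hne
  rcases lt_or_gt_of_ne hne with hlt | hlt
  · have := hpos.2 _ _ hlt
    simp [Prec, h] at this
  · have := hpos.2 _ _ hlt
    simp [Prec, h] at this

theorem HMat_apply_pos {F : Type*} [Field F] {n : ℕ} {pos : Fin n → Fin n × Fin n}
    (hpos : IsHPos pos) (k : Fin n) : HMat F pos (pos k).1 (pos k).2 = MvPolynomial.X k := by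
  have hk := hpos.1 k
  rw [HMat, if_neg (by omega), zero_add, Finset.sum_eq_single k]
  · simp
  · intro l _ hl
    exact if_neg fun h => hl (hpos.injective h)
  · simp

theorem HMat_apply_of_forall_ne {F : Type*} [Field F] {n : ℕ} {pos : Fin n → Fin n × Fin n}
    {i j : Fin n} (h : ∀ k, pos k ≠ (i, j)) :
    HMat F pos i j = if (j : ℕ) = (i : ℕ) + 1 then 1 else 0 := by
  simp [HMat, h]

theorem IsULHSuperpatternOf.isULH {F : Type*} [Field F] {n : ℕ} {pos : Fin n → Fin n × Fin n}
    (hpos : IsHPos pos) {A : Matrix (Fin n) (Fin n) (MvPolynomial (Fin n) F)}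
    (hA : IsULHSuperpatternOf A (HMat F pos)) : IsULH A := by
  have hne : ∀ i j : Fin n, (i : ℕ) < j → ∀ k, pos k ≠ (i, j) := by
    intro i j hij k hk
    have := hpos.1 k
    rw [hk] at this
    exact absurd this (not_le.2 hij)
  refine ⟨fun i j h => ?_, fun i j h => ?_⟩
  · rw [hA.1 i j (by omega), HMat_apply_of_forall_ne (hne i j (by omega)), if_pos h]
  · rw [hA.1 i j (by omega), HMat_apply_of_forall_ne (hne i j (by omega)), if_neg (by omega)]

theorem IsULHSuperpatternOf.apply_pos {F : Type*} [Field F] {n : ℕ}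
    {pos : Fin n → Fin n × Fin n} (hpos : IsHPos pos)
    {A : Matrix (Fin n) (Fin n) (MvPolynomial (Fin n) F)}
    (hA : IsULHSuperpatternOf A (HMat F pos)) (k : Fin n) :
    A (pos k).1 (pos k).2 = MvPolynomial.X k := by
  have hk := HMat_apply_pos (F := F) hpos k
  rcases hA.2 _ _ (hpos.1 k) with h | ⟨h, -⟩
  · rw [h, hk]
  · exact absurd (hk.symm.trans h) (MvPolynomial.X_ne_zero k)

theorem IsULHSuperpatternOf.exists_eq_C {F : Type*} [Field F] {n : ℕ}
    {pos : Fin n → Fin n × Fin n} {A : Matrix (Fin n) (Fin n) (MvPolynomial (Fin n) F)}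
    (hA : IsULHSuperpatternOf A (HMat F pos)) {i j : Fin n} (h : ∀ k, pos k ≠ (i, j)) :
    ∃ c : F, A i j = MvPolynomial.C c := by
  have hH : ∃ c : F, HMat F pos i j = MvPolynomial.C c := by
    rw [HMat_apply_of_forall_ne h]
    split_ifs
    · exact ⟨1, MvPolynomial.C_1.symm⟩
    · exact ⟨0, MvPolynomial.C_0.symm⟩
  rcases lt_or_ge (i : ℕ) j with hij | hij
  · rwa [hA.1 i j hij]
  · rcases hA.2 i j hij with h' | ⟨-, c, -, hc⟩
    · rwa [h']
    · exact ⟨c, hc⟩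

theorem IsULHSuperpatternOf.subdiagonal_eq {F : Type*} [Field F] {n : ℕ}
    {pos : Fin n → Fin n × Fin n} (hpos : IsHPos pos)
    {A : Matrix (Fin n) (Fin n) (MvPolynomial (Fin n) F)}
    (hA : IsULHSuperpatternOf A (HMat F pos)) (hcomp : IsCompanion A) (a : Fin n) :
    ((pos a).1 : ℕ) - ((pos a).2 : ℕ) = a := by
  refine subdiagonal_eq_of_charpoly (hA.isULH hpos) (hpos.1 a) (hA.apply_pos hpos a) ?_ hcomp.2
  intro i j hij
  by_cases h : ∃ k, pos k = (i, j)
  · obtain ⟨k, hk⟩ := h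
    refine Or.inl ⟨k, ?_, by simpa [hk] using hA.apply_pos hpos k⟩
    rintro rfl
    exact hij hk.symm
  · exact Or.inr (hA.exists_eq_C (not_exists.1 h))

/-- If `A` is a ULH superpattern of a matrix of `ℋ` in which two
distinct variables `x_r` and `x_s` lie on the same `k`-subdiagonal (i.e.
`A ∈ ℋ̃ ∖ 𝒟̃`), then `A` is not a companion matrix. -/
theorem not_isCompanion_of_same_subdiagonal {F : Type*} [Field F] {n : ℕ} (hn : 0 < n)
    (pos : Fin n → Fin n × Fin n) (hpos : IsHPos pos)
    (A : Matrix (Fin n) (Fin n) (MvPolynomial (Fin n) F))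
    (hA : IsULHSuperpatternOf A (HMat F pos))
    (a b : Fin n) (hab : a ≠ b)
    (hsame : ((pos a).1 : ℕ) - ((pos a).2 : ℕ) = ((pos b).1 : ℕ) - ((pos b).2 : ℕ)) :
    ¬ IsCompanion A := by
  intro hcomp
  exact hab (Fin.ext (by
    rw [← hA.subdiagonal_eq hpos hcomp a, ← hA.subdiagonal_eq hpos hcomp b, hsame]))
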